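/- arXiv:2402.16238 — 3 statements merged into one kernel-verified Lean document; each statement's English description precedes it below -/
import Mathlib

section
/- Let x, y, z : ℕ → ℕ be sequences with x(n) ≥ 1, y(n) ≥ 1 and z(n) ≥ 1 for n ∈ {1,2,3}, and suppose that for all n ≥ 4: x(n) = 2·y(n−1) + 1, y(n) = y(n−1) + z(n−1) + 1, and z(n) = x(n−1). Then there exist real numbers C > 0 and c > 1 such that x(n) ≥ C·cⁿ for all n ≥ 1. -/
/-- If `x n, y n, z n ≥ 1` for `n ∈ {1,2,3}` and for `n ≥ 4` one has
`x n = 2 * y (n-1) + 1`, `y n = y (n-1) + z (n-1) + 1`, `z n = x (n-1)`, then `x`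
grows at least exponentially. -/
theorem stmt_12 (x y z : ℕ → ℕ)
    (hx : ∀ n, 1 ≤ n → n ≤ 3 → 1 ≤ x n)
    (hy : ∀ n, 1 ≤ n → n ≤ 3 → 1 ≤ y n)
    (hz : ∀ n, 1 ≤ n → n ≤ 3 → 1 ≤ z n)
    (hrecx : ∀ n, 4 ≤ n → x n = 2 * y (n - 1) + 1)
    (hrecy : ∀ n, 4 ≤ n → y n = y (n - 1) + z (n - 1) + 1)
    (hrecz : ∀ n, 4 ≤ n → z n = x (n - 1)) :
    ∃ C c : ℝ, 0 < C ∧ 1 < c ∧ ∀ n : ℕ, 1 ≤ n → C * c ^ n ≤ (x n : ℝ) := by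
  have key : ∀ k : ℕ, (3 / 2 : ℝ) ^ k ≤ x (k + 3) ∧ 3 / 4 * (3 / 2 : ℝ) ^ k ≤ y (k + 3) ∧
      2 / 3 * (3 / 2 : ℝ) ^ k ≤ z (k + 3) := by
    intro k
    induction k with
    | zero =>
      have h1 : (1 : ℝ) ≤ x 3 := by exact_mod_cast hx 3 (by norm_num) le_rfl
      have h2 : (1 : ℝ) ≤ y 3 := by exact_mod_cast hy 3 (by norm_num) le_rfl
      have h3 : (1 : ℝ) ≤ z 3 := by exact_mod_cast hz 3 (by norm_num) le_rfl
      simp only [pow_zero, zero_add]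
      exact ⟨by linarith, by linarith, by linarith⟩
    | succ k ih =>
      obtain ⟨h1, h2, h3⟩ := ih
      have e1 : x (k + 1 + 3) = 2 * y (k + 3) + 1 := hrecx (k + 1 + 3) (by omega)
      have e2 : y (k + 1 + 3) = y (k + 3) + z (k + 3) + 1 := hrecy (k + 1 + 3) (by omega)
      have e3 : z (k + 1 + 3) = x (k + 3) := hrecz (k + 1 + 3) (by omega)
      have hpos : (0 : ℝ) < (3 / 2) ^ k := by positivity
      rw [e1, e2, e3, pow_succ]
      push_cast
      exact ⟨by linarith, by linarith, by linarith⟩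
  refine ⟨8 / 27, 3 / 2, by norm_num, by norm_num, fun n hn => ?_⟩
  rcases le_total n 3 with h | h
  · have h1 : (1 : ℝ) ≤ x n := by exact_mod_cast hx n hn h
    have h2 : (3 / 2 : ℝ) ^ n ≤ (3 / 2) ^ 3 := pow_le_pow_right₀ (by norm_num) h
    norm_num at h2
    linarith
  · obtain ⟨k, rfl⟩ := Nat.exists_eq_add_of_le' h
    have h1 := (key k).1
    rw [pow_add]
    linarith
end

section
/- Let Γ be a connected, locally finite, infinite graph with graph metric d. For a vertex v and R ≥ 0 let B_v(R) denote the subgraph of Γ induced on {u : d(u,v) ≤ R}; for a finite subgraph Δ let Diam(Δ) = max_{u,v ∈ V(Δ)} d(u,v), and for vertex-disjoint subgraphs Δ, Δ' let dist(Δ,Δ') be the minimum of d(u,u') over u ∈ V(Δ), u' ∈ V(Δ'). Then the following are equivalent: (a) there exists K ≥ 1 such that for every vertex v and every integer R ≥ 1 there is a subgraph of Γ isomorphic to B_v(R), vertex-disjoint from B_v(R), whose distance from v is at most K·R; (b) there exists C ≥ 1 such that for every finite connected subgraph Δ with at least two vertices there is a subgraph Δ' of Γ isomorphic to Δ, vertex-disjoint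 from Δ, with dist(Δ,Δ') ≤ C·Diam(Δ). -/
open SimpleGraph

namespace SimpleGraph

variable {V : Type*} {G : SimpleGraph V}

/-- A walk of length at most `R` ending at `v` stays in the ball of radius `R` about `v`. -/
lemma Walk.exists_induce_dist_le {R : ℕ} {u v : V} (w : G.Walk u v) (hw : w.length ≤ R)
    (hu : G.dist u v ≤ R) (hv : G.dist v v ≤ R) :
    ∃ q : (G.induce {x : V | G.dist x v ≤ R}).Walk ⟨u, hu⟩ ⟨v, hv⟩, q.length = w.length := by
  induction w with
  | nil => exact ⟨.nil, rfl⟩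
  | cons h w ih =>
    rw [Walk.length_cons] at hw
    obtain ⟨q, hq⟩ := ih (by omega) ((dist_le w).trans (by omega)) hv
    exact ⟨.cons (induce_adj.2 h) q, by simp [hq]⟩

lemma Connected.exists_walk_induce_dist_le (hG : G.Connected) {R : ℕ} {u v : V}
    (hu : G.dist u v ≤ R) (hv : G.dist v v ≤ R) :
    ∃ q : (G.induce {x : V | G.dist x v ≤ R}).Walk ⟨u, hu⟩ ⟨v, hv⟩, q.length ≤ R := by
  obtain ⟨w, hw⟩ := hG.exists_walk_length_eq_dist u v
  obtain ⟨q, hq⟩ := w.exists_induce_dist_le (hw.trans_le hu) hu hv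
  exact ⟨q, by omega⟩

lemma Connected.induce_dist_le (hG : G.Connected) (v : V) (R : ℕ) :
    (G.induce {x : V | G.dist x v ≤ R}).Connected := by
  have hv : G.dist v v ≤ R := by simp
  rw [connected_iff_exists_forall_reachable]
  exact ⟨⟨v, hv⟩, fun x ↦
    (hG.exists_walk_induce_dist_le x.2 hv).elim fun q _ ↦ q.reachable.symm⟩

lemma Connected.dist_map_induce_dist_le (hG : G.Connected) {W : Type*} {H : SimpleGraph W}
    {R : ℕ} {v : V} (f : G.induce {x : V | G.dist x v ≤ R} →g H)
    (x : {x : V | G.dist x v ≤ R}) (hv : G.dist v v ≤ R) :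
    H.dist (f x) (f ⟨v, hv⟩) ≤ R := by
  obtain ⟨q, hq⟩ := hG.exists_walk_induce_dist_le x.2 hv
  exact (dist_le (q.map f)).trans (by simpa using hq)

lemma Connected.finite_setOf_dist_le (hG : G.Connected)
    (hlf : ∀ v : V, (G.neighborSet v).Finite) (v : V) (R : ℕ) :
    {x : V | G.dist x v ≤ R}.Finite := by
  induction R with
  | zero => simp [hG.dist_eq_zero_iff]
  | succ R ih =>
    refine ((Set.finite_singleton v).union (ih.biUnion fun x _ ↦ hlf x)).subset fun x hx ↦ ?_
    obtain ⟨w, hw⟩ := hG.exists_walk_length_eq_dist x v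
    have hx : G.dist x v ≤ R + 1 := hx
    cases w with
    | nil => exact Or.inl rfl
    | @cons _ y _ h w =>
      rw [Walk.length_cons] at hw
      exact Or.inr (Set.mem_biUnion (show G.dist y v ≤ R from (dist_le w).trans (by omega))
        h.symm)

end SimpleGraph

/-- For a connected, locally finite, infinite graph `Γ`, linear repetitivity of
balls (every ball `B_v(R)` has a vertex-disjoint isomorphic copy within distance `K·R` of `v`)
is equivalent to linear repetitivity of arbitrary finite connected subgraphs (every finite
connected subgraph `Δ` with at least two vertices has a vertex-disjoint isomorphic copy within
distance `C·Diam(Δ)`). -/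
theorem stmt_14 {V : Type*} (Γ : SimpleGraph V) (hconn : Γ.Connected)
    (hlf : ∀ v : V, (Γ.neighborSet v).Finite) (hinf : Infinite V) :
    (∃ K : ℝ, 1 ≤ K ∧ ∀ v : V, ∀ R : ℕ, 1 ≤ R →
        ∃ Δ' : Γ.Subgraph,
          Nonempty (Δ'.coe ≃g Γ.induce {u : V | Γ.dist u v ≤ R}) ∧
          Disjoint Δ'.verts {u : V | Γ.dist u v ≤ R} ∧
          ∃ u ∈ Δ'.verts, (Γ.dist u v : ℝ) ≤ K * R) ↔
    (∃ C : ℝ, 1 ≤ C ∧ ∀ Δ : Γ.Subgraph, Δ.verts.Finite → Δ.Connected →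
        2 ≤ Δ.verts.ncard →
        ∃ Δ' : Γ.Subgraph,
          Nonempty (Δ'.coe ≃g Δ.coe) ∧
          Disjoint Δ.verts Δ'.verts ∧
          ∃ u ∈ Δ.verts, ∃ u' ∈ Δ'.verts,
            (Γ.dist u u' : ℝ) ≤ C * (sSup (Set.image2 Γ.dist Δ.verts Δ.verts) : ℕ)) := by
  constructor
  · rintro ⟨K, hK, h⟩
    refine ⟨K + 2, by linarith, fun Δ hfin hΔ hcard ↦ ?_⟩
    obtain ⟨v, hv, w, hw, hvw⟩ := (Set.one_lt_ncard hfin).1 hcard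
    set D := sSup (Set.image2 Γ.dist Δ.verts Δ.verts) with hD
    have hle : ∀ x ∈ Δ.verts, ∀ y ∈ Δ.verts, Γ.dist x y ≤ D := fun x hx y hy ↦
      le_csSup (hfin.image2 _ hfin).bddAbove (Set.mem_image2_of_mem hx hy)
    have hD1 : 1 ≤ D := (hconn.pos_dist_of_ne hvw).trans_le (hle v hv w hw)
    obtain ⟨B, ⟨e⟩, hdisj, u, hu, hdist⟩ := h v D hD1
    have hvv : Γ.dist v v ≤ D := by simp
    let ι : Δ.coe →g Γ.induce {x : V | Γ.dist x v ≤ D} :=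
      { toFun := fun x ↦ ⟨x, hle x x.2 v hv⟩
        map_rel' := fun {a b} hab ↦ Δ.adj_sub hab }
    have hι : Function.Injective ι := fun a b hab ↦ Subtype.ext (congrArg (fun x ↦ x.1) hab)
    let f : Γ.induce {x : V | Γ.dist x v ≤ D} →g Γ := B.hom.comp e.symm.toHom
    have hf : Function.Injective f := Subgraph.hom_injective.comp e.symm.injective
    have hfB : ∀ x, f x ∈ B.verts := fun x ↦ (e.symm x).2
    let c : Copy Δ.coe Γ := (f.comp ι).toCopy (hf.comp hι)
    refine ⟨c.toSubgraph, ⟨c.isoToSubgraph.symm⟩, ?_, v, hv, f ⟨v, hvv⟩, ?_, ?_⟩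
    · rw [Set.disjoint_left]
      rintro x hx ⟨y, -, rfl⟩
      exact Set.disjoint_left.1 hdisj (hfB (ι y)) (hle _ hx v hv)
    · exact ⟨⟨v, hv⟩, trivial, rfl⟩
    · have hfu : f (e ⟨u, hu⟩) = u := congrArg Subtype.val (e.symm_apply_apply ⟨u, hu⟩)
      have h1 := hconn.dist_map_induce_dist_le f (e ⟨u, hu⟩) hvv
      rw [hfu] at h1
      have h2 : Γ.dist v (f ⟨v, hvv⟩) ≤ Γ.dist u v + D := by
        have := hconn.dist_triangle (u := v) (v := u) (w := f ⟨v, hvv⟩)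
        rw [Γ.dist_comm (u := v) (v := u)] at this
        omega
      have h3 : (Γ.dist v (f ⟨v, hvv⟩) : ℝ) ≤ Γ.dist u v + D := by exact_mod_cast h2
      have h4 : (0 : ℝ) ≤ D := D.cast_nonneg
      linarith
  · rintro ⟨C, hC, h⟩
    refine ⟨2 * C + 1, by linarith, fun v R hR ↦ ?_⟩
    have hfin := hconn.finite_setOf_dist_le hlf v R
    set S := {x : V | Γ.dist x v ≤ R} with hS
    have hSconn : ((⊤ : Γ.Subgraph).induce S).Connected := by
      rw [Subgraph.connected_iff', ← induce_eq_coe_induce_top]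
      exact hconn.induce_dist_le v R
    have hcard : 2 ≤ S.ncard := by
      obtain ⟨w, hw⟩ := hconn.preconnected.exists_adj_of_nontrivial v
      exact (Set.one_lt_ncard hfin).2 ⟨v, by simp [hS], w,
        by simpa [hS, dist_eq_one_iff_adj.2 hw.symm] using hR, hw.ne⟩
    obtain ⟨Δ', ⟨e⟩, hdisj, u, hu, u', hu', hdist⟩ := h _ hfin hSconn hcard
    have hu : Γ.dist u v ≤ R := hu
    have hdiam : sSup (Set.image2 Γ.dist S S) ≤ 2 * R := by
      refine csSup_le ⟨_, Set.mem_image2_of_mem hu hu⟩ ?_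
      rintro _ ⟨x, hx, y, hy, rfl⟩
      have hx : Γ.dist x v ≤ R := hx
      have hy : Γ.dist y v ≤ R := hy
      have := hconn.dist_triangle (u := x) (v := v) (w := y)
      rw [Γ.dist_comm (u := v) (v := y)] at this
      omega
    refine ⟨Δ', ⟨?_⟩, hdisj.symm, u', hu', ?_⟩
    · rw [induce_eq_coe_induce_top]
      exact e
    · have h1 := hconn.dist_triangle (u := u') (v := u) (w := v)
      rw [Γ.dist_comm (u := u') (v := u)] at h1
      have h2 : (Γ.dist u' v : ℝ) ≤ Γ.dist u u' + R := by exact_mod_cast h1.trans (by omega)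
      have h3 : C * (sSup (Set.image2 Γ.dist S S) : ℕ) ≤ C * (2 * R) :=
        mul_le_mul_of_nonneg_left (by exact_mod_cast hdiam) (by linarith)
      have h4 : (Γ.dist u u' : ℝ) ≤ C * (sSup (Set.image2 Γ.dist S S) : ℕ) := hdist
      linarith
end

section
/- Let B be a Bratteli diagram, i.e. sequences (V_n)_{n≥1}, (E_n)_{n≥1} of nonempty finite sets together with surjective source maps s_n : E_n → V_n and surjective range maps r_n : E_n → V_{n+1}. Then B is simple if and only if for every infinite path η ∈ Ω(B), the cofinality class Cof(η) is dense in Ω(B). -/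
/-- In a diagram with surjective source and range maps, every edge lies on an infinite path. -/
theorem exists_path_through_edge (m : ℕ) : ∀ {V E : ℕ → Type*}
    (s : ∀ n, E n → V n) (r : ∀ n, E n → V (n + 1))
    (_ : ∀ n, Function.Surjective (s n)) (_ : ∀ n, Function.Surjective (r n)) (e : E m),
    ∃ η : ∀ n, E n, (∀ n, r n (η n) = s (n + 1) (η (n + 1))) ∧ η m = e := by
  induction m with
  | zero =>
    intro V E s r hs hr e
    choose f hf using hs
    exact ⟨fun n => Nat.rec (motive := E) e (fun k x => f (k + 1) (r k x)) n,
      fun n => (hf _ _).symm, rfl⟩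
  | succ m ih =>
    intro V E s r hs hr e
    obtain ⟨η, hη, hm⟩ := ih (V := fun n => V (n + 1)) (E := fun n => E (n + 1))
      (fun n => s (n + 1)) (fun n => r (n + 1)) (fun n => hs _) (fun n => hr _) e
    obtain ⟨e₀, he₀⟩ := hr 0 (s 1 (η 0))
    refine ⟨fun n => Nat.casesOn (motive := E) n e₀ η, ?_, hm⟩
    rintro (_ | n)
    · exact he₀
    · exact hη n

/-- There is a path of length `d + 1` from the vertex `v` of level `n` to the vertex `u`. -/
def BratteliReachable {V E : ℕ → Type*} (s : ∀ n, E n → V n) (r : ∀ n, E n → V (n + 1))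
    (n d : ℕ) (v : V n) (u : V (n + d + 1)) : Prop :=
  ∃ p : ∀ k, E k, s n (p n) = v ∧ r (n + d) (p (n + d)) = u ∧
    ∀ k, n ≤ k → k < n + d → r k (p k) = s (k + 1) (p (k + 1))

theorem BratteliReachable.extend {V E : ℕ → Type*} {s : ∀ n, E n → V n}
    {r : ∀ n, E n → V (n + 1)} {n d : ℕ} {v : V n} (e : E (n + d + 1))
    (h : BratteliReachable s r n d v (s _ e)) :
    BratteliReachable s r n (d + 1) v (r _ e) := by
  obtain ⟨p, hp, hpu, hpath⟩ := h
  refine ⟨Function.update p (n + d + 1) e, ?_, ?_, fun k hk hkd => ?_⟩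
  · rwa [Function.update_of_ne (by lia)]
  · exact congrArg (r (n + d + 1)) (Function.update_self ..)
  · rw [Function.update_of_ne (by lia)]
    rcases eq_or_ne k (n + d) with rfl | hne
    · rw [Function.update_self, hpu]
    · rw [Function.update_of_ne (by lia)]
      exact hpath k hk (by lia)

theorem BratteliReachable.mono_of_path {V E : ℕ → Type*} {s : ∀ n, E n → V n}
    {r : ∀ n, E n → V (n + 1)} {n d d' : ℕ} {v : V n} {η : ∀ n, E n}
    (hη : ∀ n, r n (η n) = s (n + 1) (η (n + 1))) (hd : d ≤ d')
    (h : BratteliReachable s r n d v (s _ (η (n + d + 1)))) :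
    BratteliReachable s r n d' v (s _ (η (n + d' + 1))) := by
  induction d', hd using Nat.le_induction with
  | base => exact h
  | succ k _ ih =>
    exact hη (n + (k + 1)) ▸ ih.extend

/-- A Bratteli diagram (levels indexed by `ℕ`, with nonempty finite vertex sets
`V n`, nonempty finite edge sets `E n`, surjective source maps `s n : E n → V n` and surjective
range maps `r n : E n → V (n+1)`) is simple if and only if every cofinality class is dense in
the path space `Ω(B)` (a subspace of the product `∀ n, E n` with each `E n` discrete). -/
theorem stmt_15 {V E : ℕ → Type*}
    [∀ n, Finite (V n)] [∀ n, Nonempty (V n)]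
    [∀ n, Finite (E n)] [∀ n, Nonempty (E n)]
    [∀ n, TopologicalSpace (E n)] [∀ n, DiscreteTopology (E n)]
    (s : ∀ n, E n → V n) (r : ∀ n, E n → V (n + 1))
    (hs : ∀ n, Function.Surjective (s n)) (hr : ∀ n, Function.Surjective (r n)) :
    -- simplicity of the diagram
    (∀ n : ℕ, ∃ d : ℕ, ∀ v : V n, ∀ u : V (n + d + 1), ∃ p : ∀ k, E k,
        s n (p n) = v ∧ r (n + d) (p (n + d)) = u ∧
        ∀ k, n ≤ k → k < n + d → r k (p k) = s (k + 1) (p (k + 1))) ↔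
    -- density of every cofinality class in the path space
    (∀ η : {e : ∀ n, E n // ∀ n, r n (e n) = s (n + 1) (e (n + 1))},
        Dense {ζ : {e : ∀ n, E n // ∀ n, r n (e n) = s (n + 1) (e (n + 1))} |
          ∃ N : ℕ, ∀ n, N ≤ n → ζ.1 n = η.1 n}) := by
  constructor
  · intro hsimple η
    rw [dense_iff_inter_open]
    rintro U hU ⟨ξ, hξ⟩
    obtain ⟨W, hW, rfl⟩ := isOpen_induced_iff.1 hU
    obtain ⟨I, w, hw, hIW⟩ := isOpen_pi_iff.1 hW ξ.1 hξ
    obtain ⟨N, hN⟩ : ∃ N, ∀ i ∈ I, i < N :=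
      ⟨I.sup id + 1, fun i hi => Nat.lt_succ_of_le (Finset.le_sup (f := id) hi)⟩
    obtain ⟨d, hd⟩ := hsimple N
    obtain ⟨p, hpv, hpu, hp⟩ := hd (s N (ξ.1 N)) (s _ (η.1 (N + d + 1)))
    refine ⟨⟨fun k => if k < N then ξ.1 k else if k ≤ N + d then p k else η.1 k, ?_⟩,
      hIW fun i hi => ?_, N + d + 1, fun k hk => ?_⟩
    · intro k
      rcases lt_trichotomy (k + 1) N with h | h | h
      · simpa [h, show k < N by lia] using ξ.2 k
      · subst h
        simpa [hpv, show k + 1 ≤ k + 1 + d by lia] using ξ.2 k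
      · rcases lt_trichotomy k (N + d) with h' | h' | h'
        · simpa [show ¬ k < N by lia, show ¬ k + 1 < N by lia, show k ≤ N + d by lia,
            show k + 1 ≤ N + d by lia] using hp k (by lia) h'
        · subst h'
          simpa [show ¬ N + d + 1 < N by lia] using hpu
        · simpa [show ¬ k < N by lia, show ¬ k + 1 < N by lia, show ¬ k ≤ N + d by lia,
            show ¬ k + 1 ≤ N + d by lia] using η.2 k
    · simpa [hN i hi] using (hw i hi).2
    · simp [show ¬ k < N by lia, show ¬ k ≤ N + d by lia]
  · intro hdense n
    let Ω := {e : ∀ n, E n // ∀ n, r n (e n) = s (n + 1) (e (n + 1))}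
    have hcont (k : ℕ) : Continuous fun η : Ω => η.1 k :=
      (continuous_apply k).comp continuous_subtype_val
    have hclosed : IsClosed {e : ∀ n, E n | ∀ n, r n (e n) = s (n + 1) (e (n + 1))} := by
      simp only [Set.ofPred_forall]
      refine isClosed_iInter fun k => ?_
      exact (isClosed_discrete {x : E k × E (k + 1) | r k x.1 = s (k + 1) x.2}).preimage
        ((continuous_apply k).prodMk (continuous_apply (k + 1)))
    have : CompactSpace Ω := isCompact_iff_compactSpace.1 hclosed.isCompact
    let U (d : ℕ) : Set Ω := {η | ∀ v, BratteliReachable s r n d v (s _ (η.1 (n + d + 1)))}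
    have hUopen (d : ℕ) : IsOpen (U d) :=
      (isOpen_discrete {e : E (n + d + 1) | ∀ v, BratteliReachable s r n d v (s _ e)}).preimage
        (hcont _)
    have hUmono : Monotone U := fun d d' hd η hη v => (hη v).mono_of_path η.2 hd
    have hUcover : Set.univ ⊆ ⋃ d, U d := by
      intro η _
      have hreach (v : V n) : ∃ d, BratteliReachable s r n d v (s _ (η.1 (n + d + 1))) := by
        obtain ⟨e, he⟩ := hs n v
        obtain ⟨ξ, hξ, hξn⟩ := exists_path_through_edge n s r hs hr e
        obtain ⟨ζ, hζ, N, hN⟩ := (hdense η).inter_open_nonempty _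
          ((isOpen_discrete {e}).preimage (hcont n)) ⟨⟨ξ, hξ⟩, hξn⟩
        refine ⟨N, ζ.1, ?_, ?_, fun k _ _ => ζ.2 k⟩
        · rw [show ζ.1 n = e from hζ, he]
        · rw [ζ.2, hN _ (by lia)]
      choose f hf using hreach
      obtain ⟨D, hD⟩ := (Set.finite_range f).bddAbove
      exact Set.mem_iUnion.2
        ⟨D, fun v => (hf v).mono_of_path η.2 (hD (Set.mem_range_self v))⟩
    obtain ⟨d, hd⟩ := isCompact_univ.elim_directed_cover U hUopen hUcover hUmono.directed_le
    refine ⟨d, fun v u => ?_⟩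
    obtain ⟨e, rfl⟩ := hs _ u
    obtain ⟨η, hη, rfl⟩ := exists_path_through_edge _ s r hs hr e
    exact hd (Set.mem_univ (⟨η, hη⟩ : Ω)) v
end
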